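/- For every NPLCS N, location q and sets of locations B₁,…,Bₙ ⊆ Q, the following are equivalent: (b.1) there exists a scheduler U with Pr_U((q,ε) ⊨ ⋁_{i=1}^n ◇□Bᵢ) = 1; (b.2) there exists a finite-memory scheduler U with Pr_U((q,ε) ⊨ ⋁_{i=1}^n ◇□Bᵢ) = 1 (indeed an almost blind, memoryless one exists); (b.3) there exists a scheduler V with Pr_V((q,ε) ⊨ ◇⋃_{i=1}^n Safe(Bᵢ)) = 1. -/

import Mathlib

open scoped ENNReal
open Classical

namespace NPLCSmodel

/-! ## Lossy channel systems -/

/-- Operations of a lossy channel system: send a message on a channel,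
receive a message from a channel, or an internal action. -/
inductive LcsOp (C M : Type) : Type where
  | send : C → M → LcsOp C M
  | recv : C → M → LcsOp C M
  | internal : LcsOp C M

def LcsOp.IsRecv {C M : Type} : LcsOp C M → Prop
  | .recv _ _ => True
  | _ => False

/-- A transition rule `src --op--> dst`. -/
structure LcsRule (Q C M : Type) : Type where
  src : Q
  op : LcsOp C M
  dst : Q

/-- Channel contents: a word over `M` for each channel. -/
abbrev Chans (C M : Type) : Type := C → List M

/-- Configurations: a location together with channel contents. -/
abbrev Conf (Q C M : Type) : Type := Q × Chans C M

/-- The empty channel contents ε. -/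
def eps (C M : Type) : Chans C M := fun _ => []

variable {Q C M : Type}

/-- When is an operation possible on channel contents `w`? -/
def enabledOp : LcsOp C M → Chans C M → Prop
  | .recv c m, w => ∃ v, w c = m :: v
  | .send _ _, _ => True
  | .internal, _ => True

/-- Effect of an operation on the channel contents (for a perfect step). -/
def applyOp [DecidableEq C] : LcsOp C M → Chans C M → Chans C M
  | .send c m, w => Function.update w c (w c ++ [m])
  | .recv c _, w => Function.update w c (w c).tail
  | .internal, w => w

/-- A rule is enabled in a configuration. -/
def LcsRule.EnabledIn (δ : LcsRule Q C M) (s : Conf Q C M) : Prop :=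
  δ.src = s.1 ∧ enabledOp δ.op s.2

/-- A lossy channel system `L = (Q, C, M, Δ)` (the finiteness of the location,
channel and message types is imposed by `Fintype` assumptions at use sites):
a finite set of transition rules such that every location has at least one
outgoing rule that is not a receive. -/
structure LCS (Q C M : Type) : Type where
  rules : Set (LcsRule Q C M)
  finiteRules : rules.Finite
  noDeadlock : ∀ q : Q, ∃ δ ∈ rules, δ.src = q ∧ ¬ δ.op.IsRecv

variable [DecidableEq C]

/-- Lossy step via rule `δ`: a perfect step followed by losing arbitrarily
many messages (`<+` is the (componentwise) subword relation). -/
def LCS.StepVia (L : LCS Q C M) (s : Conf Q C M) (δ : LcsRule Q C M)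
    (t : Conf Q C M) : Prop :=
  δ ∈ L.rules ∧ δ.EnabledIn s ∧ t.1 = δ.dst ∧ ∀ c, List.Sublist (t.2 c) (applyOp δ.op s.2 c)

/-- Lossy step `s → t`. -/
def LCS.Step (L : LCS Q C M) (s t : Conf Q C M) : Prop := ∃ δ, L.StepVia s δ t

/-- Reachability `s →* t`. -/
def LCS.Reach (L : LCS Q C M) : Conf Q C M → Conf Q C M → Prop :=
  Relation.ReflTransGen L.Step

/-- Constrained reachability `s →*_[X) t`: all configurations along the path,
except possibly the last one, have their location in `X`. -/
def LCS.ReachWithin (L : LCS Q C M) (X : Set Q) : Conf Q C M → Conf Q C M → Prop :=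
  Relation.ReflTransGen (fun a b => L.Step a b ∧ a.1 ∈ X)

/-- Constrained reachability `s →*_[X] t`: all configurations along the path,
including `s` and `t`, have their location in `X`. -/
def LCS.ReachConstrained (L : LCS Q C M) (X : Set Q) (s t : Conf Q C M) : Prop :=
  L.ReachWithin X s t ∧ t.1 ∈ X

/-- `X` is safe for `A`. -/
def LCS.IsSafeFor (L : LCS Q C M) (A X : Set Q) : Prop :=
  X ⊆ A ∧ ∀ x ∈ X, ∃ t, L.Step (x, eps C M) t ∧ t.1 ∈ X

/-- `Safe(A)`: the largest set safe for `A` (the union of all such sets). -/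
def LCS.Safe (L : LCS Q C M) (A : Set Q) : Set Q := ⋃₀ {X | L.IsSafeFor A X}

/-- `X` is promising for `A`. -/
def LCS.IsPromisingFor (L : LCS Q C M) (A X : Set Q) : Prop :=
  ∀ x ∈ X, ∃ t, L.ReachWithin X (x, eps C M) t ∧ t.1 ∈ A

/-- `Prom(A)`: the largest set promising for `A` (the union of all such sets). -/
def LCS.Prom (L : LCS Q C M) (A : Set Q) : Set Q := ⋃₀ {X | L.IsPromisingFor A X}

/-! ## NPLCS and the induced Markov decision process -/

/-- An NPLCS: an LCS together with a fault rate `τ ∈ (0,1)`. -/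
structure NPLCS (Q C M : Type) : Type where
  L : LCS Q C M
  τ : ℝ
  τ_pos : 0 < τ
  τ_lt_one : τ < 1

/-- The number of embeddings of the second list as a subword of the first. -/
def countEmb [DecidableEq M] : List M → List M → ℕ
  | _, [] => 1
  | [], _ :: _ => 0
  | a :: v, b :: w => (if a = b then countEmb v w else 0) + countEmb v (b :: w)

variable [Fintype C] [DecidableEq M]

/-- Total number of messages in the channels. -/
def chansSize (w : Chans C M) : ℕ := ∑ c, (w c).length

/-- `P_lost(v,v') = τ^(|v|-|v'|) · (1-τ)^|v'| · C(v,v')`, the probability that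
channel contents `v` become `v'` through message losses. -/
noncomputable def plost (τ : ℝ) (v v' : Chans C M) : ℝ≥0∞ :=
  ENNReal.ofReal
    (τ ^ (chansSize v - chansSize v') * (1 - τ) ^ chansSize v' *
      (∏ c, countEmb (v c) (v' c) : ℕ))

/-- One-step probability `P_N(s, δ, t)` of the MDP of an NPLCS. -/
noncomputable def NPLCS.stepProb (N : NPLCS Q C M) (s : Conf Q C M)
    (δ : LcsRule Q C M) (t : Conf Q C M) : ℝ≥0∞ :=
  if δ ∈ N.L.rules ∧ δ.EnabledIn s ∧ t.1 = δ.dst then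
    plost N.τ (applyOp δ.op s.2) t.2
  else 0

/-! ## Probability measure of a countable-state Markov chain

Given one-step probabilities `k` on a state space `S`, the measure of a set of
trajectories is the Carathéodory outer measure generated by the probabilities
of cylinder sets; it agrees with the usual Markov-chain measure on all
measurable (in particular, on all ω-regular) sets of trajectories. -/

section Chain
variable {S : Type}

/-- Probability that the chain starting in `s` performs the finite sequence
of steps through the configurations listed in `l`. -/
noncomputable def chainPathProb (k : S → S → ℝ≥0∞) : S → List S → ℝ≥0∞
  | _, [] => 1
  | s, t :: l => k s t * chainPathProb k t l

/-- The cylinder of trajectories starting with `s` followed by `l`. -/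
def chainCyl (s : S) (l : List S) : Set (ℕ → S) :=
  {ω | ω 0 = s ∧ ∀ (i : ℕ) (h : i < l.length), ω (i + 1) = l.get ⟨i, h⟩}

/-- Premeasure: probability of a cylinder set, `∞` on other (nonempty) sets. -/
noncomputable def chainFun (k : S → S → ℝ≥0∞) (s : S) (A : Set (ℕ → S)) : ℝ≥0∞ :=
  if A = ∅ then 0 else ⨅ (l : List S) (_ : A = chainCyl s l), chainPathProb k s l

theorem chainFun_empty (k : S → S → ℝ≥0∞) (s : S) : chainFun k s ∅ = 0 := by
  simp [chainFun]

/-- The probability, for the Markov chain with one-step probabilities `k`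
started in `s`, of the set `E` of trajectories (paths starting in `s`). -/
noncomputable def chainPr (k : S → S → ℝ≥0∞) (s : S) (E : Set (ℕ → S)) : ℝ≥0∞ :=
  MeasureTheory.OuterMeasure.ofFunction (chainFun k s) (chainFun_empty k s)
    (E ∩ {ω | ω 0 = s})

end Chain

/-! ## Schedulers -/

/-- A (history-dependent, deterministic) scheduler: given the history
`h = s₁ → ⋯ → s_{n-1}` and the current configuration `sₙ`, it chooses a
transition rule of `N` enabled in `sₙ`. -/
structure Scheduler (N : NPLCS Q C M) : Type where
  choose : List (Conf Q C M) → Conf Q C M → LcsRule Q C M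
  choose_mem : ∀ h s, choose h s ∈ N.L.rules
  choose_enabled : ∀ h s, (choose h s).EnabledIn s

variable {N : NPLCS Q C M}

/-- The Markov chain `MC_U` induced by a scheduler: its states are finite
paths, represented as (history, current configuration). -/
noncomputable def Scheduler.kernel (U : Scheduler N) :
    List (Conf Q C M) × Conf Q C M → List (Conf Q C M) × Conf Q C M → ℝ≥0∞ :=
  fun a b =>
    if b.1 = a.1 ++ [a.2] then N.stepProb a.2 (U.choose a.1 a.2) b.2 else 0

/-- `Pr_U(s ⊨ E)`: the probability, under scheduler `U` with starting
configuration `s`, of the set `E` of infinite paths (trajectories of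
configurations). -/
noncomputable def Scheduler.Pr (U : Scheduler N) (s : Conf Q C M)
    (E : Set (ℕ → Conf Q C M)) : ℝ≥0∞ :=
  chainPr U.kernel ([], s) {ω | (fun i => (ω i).2) ∈ E}

/-- Memoryless scheduler: the decision depends only on the current
configuration. -/
def Scheduler.Memoryless (U : Scheduler N) : Prop :=
  ∀ h h' s, U.choose h s = U.choose h' s

/-- Blind scheduler: the decision depends only on the sequence of locations
that have been visited. -/
def Scheduler.Blind (U : Scheduler N) : Prop :=
  ∀ h h' s s', h.map Prod.fst = h'.map Prod.fst → s.1 = s'.1 →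
    U.choose h s = U.choose h' s'

/-- Finite-memory scheduler data: finitely many modes, a starting mode, a
decision rule and a next-mode function. -/
structure FMScheduler (N : NPLCS Q C M) : Type 1 where
  Mode : Type
  modeFin : Fintype Mode
  init : Mode
  D : Mode → Conf Q C M → LcsRule Q C M
  upd : Mode → Conf Q C M → Mode
  D_mem : ∀ u s, D u s ∈ N.L.rules
  D_enabled : ∀ u s, (D u s).EnabledIn s

/-- A scheduler is finite-memory if it is induced by finite-memory data. -/
def Scheduler.FiniteMemory (U : Scheduler N) : Prop :=
  ∃ fm : FMScheduler N, ∀ h s, U.choose h s = fm.D (h.foldl fm.upd fm.init) s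

/-- The Markov chain `MC_U` of a finite-memory scheduler: states are pairs
`s_u` of a configuration `s` and a mode `u`. -/
noncomputable def FMScheduler.kernel (fm : FMScheduler N) :
    Conf Q C M × fm.Mode → Conf Q C M × fm.Mode → ℝ≥0∞ :=
  fun a b =>
    if b.2 = fm.upd a.2 a.1 then N.stepProb a.1 (fm.D a.2 a.1) b.1 else 0

/-- Probability measure of the Markov chain `MC_U` of a finite-memory
scheduler, over trajectories of (configuration, mode) states. -/
noncomputable def FMScheduler.PrMC (fm : FMScheduler N)
    (a : Conf Q C M × fm.Mode) (E : Set (ℕ → Conf Q C M × fm.Mode)) : ℝ≥0∞ :=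
  chainPr fm.kernel a E

/-- Reachability in the Markov chain `MC_U` of a finite-memory scheduler. -/
def FMScheduler.MCReach (fm : FMScheduler N) :
    Conf Q C M × fm.Mode → Conf Q C M × fm.Mode → Prop :=
  Relation.ReflTransGen (fun a b => 0 < fm.kernel a b)

/-- The history (the first `i` configurations) of a trajectory. -/
def histTo (ω : ℕ → Conf Q C M) (i : ℕ) : List (Conf Q C M) :=
  (List.range i).map ω

/-- Almost blind scheduler: there are a scheduler `W` and a blind scheduler
`V` such that from any starting configuration, almost surely the choices of
`U` along the path agree with those of `W` up to some finite time and with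
those of `V` afterwards. -/
def Scheduler.AlmostBlind (U : Scheduler N) : Prop :=
  ∃ W V : Scheduler N, V.Blind ∧ ∀ s : Conf Q C M,
    U.Pr s {ω | ∃ n : ℕ,
      (∀ i ≤ n, U.choose (histTo ω i) (ω i) = W.choose (histTo ω i) (ω i)) ∧
      (∀ i, n < i → U.choose (histTo ω i) (ω i) = V.choose (histTo ω i) (ω i))} = 1

/-! ## LTL-style events on trajectories -/

/-- `□P` -/
def evAlways {α : Type} (P : α → Prop) : Set (ℕ → α) := {ω | ∀ i, P (ω i)}

/-- `◇P` -/
def evEventually {α : Type} (P : α → Prop) : Set (ℕ → α) := {ω | ∃ i, P (ω i)}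

/-- `□◇P` -/
def evInfOften {α : Type} (P : α → Prop) : Set (ℕ → α) :=
  {ω | ∀ n, ∃ i, n ≤ i ∧ P (ω i)}

/-- `◇□P` -/
def evEvAlways {α : Type} (P : α → Prop) : Set (ℕ → α) :=
  {ω | ∃ n, ∀ i, n ≤ i → P (ω i)}

/-- The atomic proposition "the current location belongs to `A`". -/
def inLoc (A : Set Q) : Conf Q C M → Prop := fun s => s.1 ∈ A


/-! ## Almost sure events of a countable-state Markov chain -/

section ChainLemmas
variable {S : Type} {k : S → S → ℝ≥0∞} {s t : S}

/-- Prepend a state to a trajectory. -/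
def consSeq (s : S) (ω : ℕ → S) : ℕ → S
  | 0 => s
  | n + 1 => ω n

theorem ofFunction_chainCyl_le (k : S → S → ℝ≥0∞) (s : S) (l : List S) :
    MeasureTheory.OuterMeasure.ofFunction (chainFun k s) (chainFun_empty k s) (chainCyl s l) ≤
      chainPathProb k s l := by
  refine (MeasureTheory.OuterMeasure.ofFunction_le _).trans ?_
  unfold chainFun
  split_ifs with h
  · exact zero_le
  · exact iInf_le_of_le l (iInf_le_of_le rfl le_rfl)

theorem chainPr_mono {E F : Set (ℕ → S)} (h : E ⊆ F) : chainPr k s E ≤ chainPr k s F :=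
  MeasureTheory.measure_mono (Set.inter_subset_inter_left _ h)

theorem chainPr_le_one (E : Set (ℕ → S)) : chainPr k s E ≤ 1 := by
  refine (MeasureTheory.measure_mono ?_).trans (ofFunction_chainCyl_le k s [])
  rintro ω ⟨-, hω⟩
  exact ⟨hω, by simp⟩

theorem chainPr_iUnion_le {ι : Type*} [Countable ι] (E : ι → Set (ℕ → S)) :
    chainPr k s (⋃ i, E i) ≤ ∑' i, chainPr k s (E i) := by
  unfold chainPr
  rw [Set.iUnion_inter]
  exact MeasureTheory.measure_iUnion_le _

theorem chainPr_iUnion_null {ι : Type*} [Countable ι] {E : ι → Set (ℕ → S)}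
    (h : ∀ i, chainPr k s (E i) = 0) : chainPr k s (⋃ i, E i) = 0 := by
  refine le_antisymm ((chainPr_iUnion_le E).trans ?_) zero_le
  simp [h]

theorem chainPr_union_le (E F : Set (ℕ → S)) :
    chainPr k s (E ∪ F) ≤ chainPr k s E + chainPr k s F := by
  unfold chainPr
  rw [Set.union_inter_distrib_right]
  exact MeasureTheory.measure_union_le _ _

theorem chainPr_union_null {s : S} {E F : Set (ℕ → S)} (hE : chainPr k s E = 0)
    (hF : chainPr k s F = 0) : chainPr k s (E ∪ F) = 0 :=
  le_antisymm ((chainPr_union_le E F).trans_eq (by rw [hE, hF, add_zero])) zero_le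

theorem chainPr_mono_null {E F : Set (ℕ → S)} (h : ∀ ω, ω 0 = s → ω ∈ E → ω ∈ F)
    (hF : chainPr k s F = 0) : chainPr k s E = 0 := by
  refine le_antisymm (le_trans ?_ hF.le) zero_le
  exact MeasureTheory.measure_mono fun ω hω => ⟨h ω hω.2 hω.1, hω.2⟩

theorem consSeq_image_chainCyl (s t : S) (l : List S) :
    consSeq s '' chainCyl t l ⊆ chainCyl s (t :: l) := by
  rintro _ ⟨ω, ⟨h0, hl⟩, rfl⟩
  refine ⟨rfl, fun i hi => ?_⟩
  cases i with
  | zero => exact h0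
  | succ i => exact hl i (by simpa using hi)

/-- One-step decomposition of the probability of an event. -/
theorem chainPr_step [Countable S] (hk : ∀ s t, k s t ≠ ∞) (s : S) (E : Set (ℕ → S)) :
    chainPr k s E ≤ ∑' t, k s t * chainPr k t {ω | consSeq s ω ∈ E} := by
  set O : S → MeasureTheory.OuterMeasure (ℕ → S) :=
    fun s => MeasureTheory.OuterMeasure.ofFunction (chainFun k s) (chainFun_empty k s) with hO
  have key : ∀ t, MeasureTheory.OuterMeasure.restrict {ω : ℕ → S | ω 0 = t}
      (MeasureTheory.OuterMeasure.comap (consSeq s) (O s)) ≤ k s t • O t := by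
    intro t
    rw [hO, MeasureTheory.OuterMeasure.smul_ofFunction (hk s t),
      MeasureTheory.OuterMeasure.le_ofFunction]
    intro A
    rw [MeasureTheory.OuterMeasure.restrict_apply, MeasureTheory.OuterMeasure.comap_apply,
      Pi.smul_apply, smul_eq_mul]
    by_cases h0 : k s t = 0
    · rw [h0, zero_mul]
      refine (MeasureTheory.measure_mono ?_).trans
        ((ofFunction_chainCyl_le k s [t]).trans (by simp [chainPathProb, h0]))
      refine subset_trans (Set.image_mono ?_) (consSeq_image_chainCyl s t [])
      exact fun ω hω => ⟨hω.2, by simp⟩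
    · unfold chainFun
      split_ifs with hA
      · simp [hA]
      · rw [ENNReal.mul_iInf_of_ne h0 (hk s t)]
        refine le_iInf fun l => ?_
        rw [ENNReal.mul_iInf_of_ne h0 (hk s t)]
        refine le_iInf fun hl => ?_
        refine (MeasureTheory.measure_mono ?_).trans (ofFunction_chainCyl_le k s (t :: l))
        subst hl
        exact (Set.image_mono Set.inter_subset_left).trans (consSeq_image_chainCyl s t l)
  have hsub : E ∩ {ω | ω 0 = s} ⊆
      ⋃ t, consSeq s '' ({ω | consSeq s ω ∈ E} ∩ {ω | ω 0 = t} ∩ {ω | ω 0 = t}) := by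
    rintro ω ⟨hE, h0⟩
    have hω : consSeq s (fun n => ω (n + 1)) = ω := by
      funext n
      cases n with
      | zero => exact h0.symm
      | succ n => rfl
    refine Set.mem_iUnion.2 ⟨ω 1, fun n => ω (n + 1), ⟨⟨?_, rfl⟩, rfl⟩, hω⟩
    rw [Set.mem_ofPred_eq, hω]
    exact hE
  refine (MeasureTheory.measure_mono hsub).trans ((MeasureTheory.measure_iUnion_le _).trans ?_)
  refine ENNReal.tsum_le_tsum fun t => ?_
  have := key t ({ω | consSeq s ω ∈ E} ∩ {ω | ω 0 = t})
  rwa [MeasureTheory.OuterMeasure.restrict_apply, MeasureTheory.OuterMeasure.comap_apply] at this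

/-! ### Total mass -/

/-- Probability of an optional cylinder. -/
noncomputable def optPathProb (k : S → S → ℝ≥0∞) (s : S) : Option (List S) → ℝ≥0∞
  | none => 0
  | some l => chainPathProb k s l

/-- The optional cylinder that remains after a step to `t`. -/
noncomputable def optResidual (t : S) : Option (List S) → Option (List S)
  | some (t' :: l) => if t' = t then some l else none
  | _ => none

theorem tsum_optPathProb_residual_le (s : S) (o : Option (List S)) :
    ∑' t, k s t * optPathProb k t (optResidual t o) ≤ optPathProb k s o := by
  rcases o with _ | _ | ⟨t', l⟩
  · simp [optResidual, optPathProb]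
  · simp [optResidual, optPathProb]
  · rw [tsum_eq_single t']
    · simp [optResidual, optPathProb, chainPathProb]
    · intro t ht
      simp [optResidual, optPathProb, ht.symm]

theorem exists_residual_lt_one (hk : ∀ s, ∑' t, k s t = 1) (s : S) (c : ℕ → Option (List S))
    (hc : ∑' n, optPathProb k s (c n) < 1) :
    ∃ t, ∑' n, optPathProb k t (optResidual t (c n)) < 1 := by
  by_contra! hcon
  refine absurd hc (not_lt.2 ?_)
  calc (1 : ℝ≥0∞) = ∑' t, k s t * 1 := by simp [hk]
    _ ≤ ∑' t, k s t * ∑' n, optPathProb k t (optResidual t (c n)) :=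
        ENNReal.tsum_le_tsum fun t => by gcongr; exact hcon t
    _ = ∑' t, ∑' n, k s t * optPathProb k t (optResidual t (c n)) := by
        simp_rw [ENNReal.tsum_mul_left]
    _ = ∑' n, ∑' t, k s t * optPathProb k t (optResidual t (c n)) := ENNReal.tsum_comm
    _ ≤ _ := ENNReal.tsum_le_tsum fun n => tsum_optPathProb_residual_le s (c n)

/-- Countably many cylinders of total probability less than one miss some trajectory. -/
theorem exists_notMem_cylinders (hk : ∀ s, ∑' t, k s t = 1) (s : S) (c : ℕ → Option (List S))
    (hc : ∑' n, optPathProb k s (c n) < 1) :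
    ∃ ω : ℕ → S, ω 0 = s ∧ ∀ n l, c n = some l → ω ∉ chainCyl s l := by
  let X := {p : S × (ℕ → Option (List S)) // ∑' n, optPathProb k p.1 (p.2 n) < 1}
  have hnext : ∀ x : X, ∃ y : X, ∀ n, y.1.2 n = optResidual y.1.1 (x.1.2 n) := by
    intro x
    obtain ⟨t, ht⟩ := exists_residual_lt_one hk x.1.1 x.1.2 x.2
    exact ⟨⟨(t, fun n => optResidual t (x.1.2 n)), ht⟩, fun n => rfl⟩
  choose next hnext using hnext
  have main : ∀ (l : List S) (x : X) (n : ℕ), x.1.2 n = some l →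
      ¬ ∀ (i : ℕ) (h : i < l.length), (next^[i + 1] x).1.1 = l.get ⟨i, h⟩ := by
    intro l
    induction l with
    | nil =>
      intro x n hn _
      have h1 := (ENNReal.le_tsum (f := fun n => optPathProb k x.1.1 (x.1.2 n)) n).trans_lt x.2
      simp [hn, optPathProb, chainPathProb] at h1
    | cons t l ih =>
      intro x n hn hx
      have h0 : (next x).1.1 = t := hx 0 (by simp)
      refine ih (next x) n ?_ fun i hi => ?_
      · rw [hnext, hn, optResidual, if_pos h0.symm]
      · exact hx (i + 1) (by simpa using hi)
  refine ⟨fun i => (next^[i] ⟨(s, c), hc⟩).1.1, rfl, fun n l hn hω => ?_⟩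
  exact main l ⟨(s, c), hc⟩ n hn hω.2

theorem one_le_chainPr_univ (hk : ∀ s, ∑' t, k s t = 1) (s : S) :
    1 ≤ chainPr k s Set.univ := by
  unfold chainPr
  rw [MeasureTheory.OuterMeasure.ofFunction_apply]
  refine le_iInf fun A => le_iInf fun hA => ?_
  by_contra! hlt
  obtain ⟨ε, hε, hεlt⟩ := ENNReal.exists_pos_sum_of_countable' (ι := ℕ)
    (ε := 1 - ∑' n, chainFun k s (A n)) (tsub_pos_of_lt hlt).ne'
  have hc : ∀ n, ∃ o : Option (List S), optPathProb k s o ≤ chainFun k s (A n) + ε n ∧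
      (∀ ω ∈ A n, ∃ l, o = some l ∧ ω ∈ chainCyl s l) := by
    intro n
    by_cases hn : A n = ∅
    · exact ⟨none, by simp [optPathProb], by simp [hn]⟩
    · have hfin : chainFun k s (A n) ≠ ∞ :=
        ((ENNReal.le_tsum n).trans_lt (hlt.trans ENNReal.one_lt_top)).ne
      have h1 : chainFun k s (A n) < chainFun k s (A n) + ε n :=
        ENNReal.lt_add_right hfin (hε n).ne'
      have h2 := h1
      nth_rewrite 1 [chainFun] at h2
      rw [if_neg hn] at h2
      obtain ⟨l, hl⟩ := iInf_lt_iff.1 h2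
      obtain ⟨hAl, hl⟩ := iInf_lt_iff.1 hl
      exact ⟨some l, hl.le, fun ω hω => ⟨l, rfl, hAl ▸ hω⟩⟩
  choose o ho ho' using hc
  have hsum : ∑' n, optPathProb k s (o n) < 1 := by
    calc ∑' n, optPathProb k s (o n) ≤ ∑' n, (chainFun k s (A n) + ε n) :=
          ENNReal.tsum_le_tsum ho
      _ = ∑' n, chainFun k s (A n) + ∑' n, ε n := ENNReal.tsum_add
      _ < ∑' n, chainFun k s (A n) + (1 - ∑' n, chainFun k s (A n)) :=
          ENNReal.add_lt_add_left (hlt.trans ENNReal.one_lt_top).ne hεlt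
      _ = 1 := add_tsub_cancel_of_le hlt.le
  obtain ⟨ω, h0, hω⟩ := exists_notMem_cylinders hk s o hsum
  obtain ⟨n, hn⟩ := Set.mem_iUnion.1 (hA ⟨Set.mem_univ ω, h0⟩)
  obtain ⟨l, hl, hωl⟩ := ho' n ω hn
  exact hω n l hl hωl

theorem chainPr_eq_one_of_compl (hk : ∀ s, ∑' t, k s t = 1) {E : Set (ℕ → S)}
    (h : chainPr k s Eᶜ = 0) : chainPr k s E = 1 := by
  refine le_antisymm (chainPr_le_one E) ?_
  calc 1 ≤ chainPr k s Set.univ := one_le_chainPr_univ hk s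
    _ = chainPr k s (E ∪ Eᶜ) := by rw [Set.union_compl_self]
    _ ≤ chainPr k s E + chainPr k s Eᶜ := chainPr_union_le _ _
    _ = chainPr k s E := by rw [h, add_zero]

/-- An event that contains an almost sure event up to a null set is almost sure. -/
theorem chainPr_eq_one_of_diff_null {E F : Set (ℕ → S)} (hE : chainPr k s E = 1)
    (h : chainPr k s (E \ F) = 0) : chainPr k s F = 1 := by
  refine le_antisymm (chainPr_le_one F) ?_
  calc 1 = chainPr k s E := hE.symm
    _ ≤ chainPr k s (F ∪ E \ F) := chainPr_mono (by simp)
    _ ≤ chainPr k s F + chainPr k s (E \ F) := chainPr_union_le _ _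
    _ = chainPr k s F := by rw [h, add_zero]

theorem kernel_ne_top (hk : ∀ s, ∑' t, k s t = 1) (s t : S) : k s t ≠ ∞ :=
  ((ENNReal.le_tsum t).trans_lt ((hk s).trans_lt ENNReal.one_lt_top)).ne

variable [Countable S]

theorem chainPr_shift_null (hk : ∀ s, ∑' t, k s t = 1) {F : Set (ℕ → S)}
    (hF : ∀ s, chainPr k s F = 0) (n : ℕ) (s : S) :
    chainPr k s {ω | (fun i => ω (i + n)) ∈ F} = 0 := by
  induction n generalizing s with
  | zero => exact hF s
  | succ n ih =>
    refine le_antisymm ((chainPr_step (kernel_ne_top hk) s _).trans ?_) zero_le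
    refine (ENNReal.tsum_eq_zero.2 fun t => ?_).le
    rw [← mul_zero (k s t), ← ih t]
    rfl

/-- If the chain almost surely enters `A` from every state, it almost surely does so infinitely
often. -/
theorem chainPr_not_infOften_null (hk : ∀ s, ∑' t, k s t = 1) {D A : Set S}
    (h : ∀ s, chainPr k s (evInfOften (· ∈ D) ∩ evAlways (· ∉ A)) = 0) (s : S) :
    chainPr k s (evInfOften (· ∈ D) \ evInfOften (· ∈ A)) = 0 := by
  refine chainPr_mono_null (F := ⋃ n : ℕ, {ω | (fun i => ω (i + n)) ∈
    evInfOften (· ∈ D) ∩ evAlways (· ∉ A)}) ?_ (chainPr_iUnion_null fun n =>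
      chainPr_shift_null hk h n s)
  rintro ω - ⟨hD, hA⟩
  simp only [evInfOften, Set.mem_ofPred_eq, not_forall, not_exists, not_and] at hA
  obtain ⟨n, hn⟩ := hA
  refine Set.mem_iUnion.2 ⟨n, fun m => ?_, fun i => hn _ (by omega)⟩
  obtain ⟨i, hi, hiD⟩ := hD (m + n)
  exact ⟨i - n, by omega, by simpa [Nat.sub_add_cancel (show n ≤ i by omega)] using hiD⟩

/-- Almost surely only transitions of positive probability are taken. -/
theorem chainPr_zero_step_null (hk : ∀ s, ∑' t, k s t = 1) (s : S) :
    chainPr k s {ω | ∃ i, k (ω i) (ω (i + 1)) = 0} = 0 := by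
  have h0 : ∀ s, chainPr k s {ω | k (ω 0) (ω 1) = 0} = 0 := by
    intro s
    refine le_antisymm ((chainPr_step (kernel_ne_top hk) s _).trans ?_) zero_le
    refine (ENNReal.tsum_eq_zero.2 fun t => ?_).le
    by_cases ht : k s t = 0
    · simp [ht]
    · rw [chainPr_mono_null (F := ∅) _ (by simp [chainPr]), mul_zero]
      rintro ω rfl hω
      exact ht hω
  refine chainPr_mono_null ?_ (chainPr_iUnion_null fun n => chainPr_shift_null hk h0 n s)
  rintro ω - ⟨i, hi⟩
  refine Set.mem_iUnion.2 ⟨i, ?_⟩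
  simpa [add_comm] using hi

/-! ### Avoiding a set of states -/

/-- Probability that the first `n + 1` states avoid `A`. -/
noncomputable def avoidProb (k : S → S → ℝ≥0∞) (A : Set S) : ℕ → S → ℝ≥0∞
  | 0, s => if s ∈ A then 0 else 1
  | n + 1, s => if s ∈ A then 0 else ∑' t, k s t * avoidProb k A n t

/-- Probability that `D` is visited for the first time in step `n`. -/
noncomputable def firstHitProb (k : S → S → ℝ≥0∞) (D : Set S) : ℕ → S → ℝ≥0∞
  | 0, s => if s ∈ D then 1 else 0
  | n + 1, s => if s ∈ D then 0 else ∑' t, k s t * firstHitProb k D n t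

omit [Countable S] in
theorem avoidProb_le_one (hk : ∀ s, ∑' t, k s t = 1) (A : Set S) (n : ℕ) (s : S) :
    avoidProb k A n s ≤ 1 := by
  induction n generalizing s with
  | zero => unfold avoidProb; split_ifs <;> simp
  | succ n ih =>
    unfold avoidProb
    split_ifs
    · simp
    · rw [← hk s]
      refine ENNReal.tsum_le_tsum fun t => ?_
      simpa using mul_le_mul_right (ih t) (k s t)

omit [Countable S] in
theorem sum_firstHitProb_le_one (hk : ∀ s, ∑' t, k s t = 1) (D : Set S) (n : ℕ) (s : S) :
    ∑ i ∈ Finset.range n, firstHitProb k D i s ≤ 1 := by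
  induction n generalizing s with
  | zero => simp
  | succ n ih =>
    rw [Finset.sum_range_succ']
    by_cases hs : s ∈ D
    · simp [firstHitProb, hs]
    · simp only [firstHitProb, hs, if_false, add_zero]
      rw [← Summable.tsum_finsetSum fun _ _ => ENNReal.summable, ← hk s]
      refine ENNReal.tsum_le_tsum fun t => ?_
      rw [← Finset.mul_sum]
      simpa using mul_le_mul_right (ih t) (k s t)

theorem chainPr_evAlways_notMem_le (hk : ∀ s, ∑' t, k s t = 1) {A : Set S} {F : Set (ℕ → S)}
    (hF : ∀ s ω, consSeq s ω ∈ F → s ∉ A ∧ ω ∈ F) {u : ℝ≥0∞} (hu : ∀ s, chainPr k s F ≤ u)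
    (n : ℕ) (s : S) : chainPr k s F ≤ avoidProb k A n s * u := by
  have hA : ∀ s ∈ A, chainPr k s F = 0 := by
    intro s hs
    refine chainPr_mono_null (F := ∅) (fun ω h0 hω => ?_) (by simp [chainPr])
    refine absurd hs (hF s (fun n => ω (n + 1)) ?_).1
    convert hω using 1
    funext n
    cases n with
    | zero => exact h0.symm
    | succ n => rfl
  by_cases hs : s ∈ A
  · rw [hA s hs]; exact zero_le
  induction n generalizing s with
  | zero => simpa [avoidProb, hs] using hu s
  | succ n ih =>
    rw [avoidProb, if_neg hs, ← ENNReal.tsum_mul_right]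
    refine (chainPr_step (kernel_ne_top hk) s F).trans (ENNReal.tsum_le_tsum fun t => ?_)
    rw [mul_assoc]
    gcongr
    refine (chainPr_mono fun ω hω => (hF s ω hω).2).trans ?_
    by_cases ht : t ∈ A
    · rw [hA t ht]; exact zero_le
    · exact ih t ht

/-- If a set `A` is reached with probability bounded away from zero from each state of `D`, then
almost surely `D` is not visited infinitely often while avoiding `A`. -/
theorem chainPr_infOften_avoid_null (hk : ∀ s, ∑' t, k s t = 1) {D A : Set S} {ρ : ℝ≥0∞}
    (hρ : ρ < 1) (h : ∀ s ∈ D, ∃ n, avoidProb k A n s ≤ ρ) (s : S) :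
    chainPr k s (evInfOften (· ∈ D) ∩ evAlways (· ∉ A)) = 0 := by
  set F : Set (ℕ → S) := evInfOften (· ∈ D) ∩ evAlways (· ∉ A) with hFdef
  have hF : ∀ s ω, consSeq s ω ∈ F → s ∉ A ∧ ω ∈ F := by
    rintro s ω ⟨h1, h2⟩
    refine ⟨h2 0, fun n => ?_, fun i => h2 (i + 1)⟩
    obtain ⟨i, hi, hiD⟩ := h1 (n + 1)
    cases i with
    | zero => omega
    | succ i => exact ⟨i, by omega, hiD⟩
  set u : ℝ≥0∞ := ⨆ s, chainPr k s F with hu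
  have hu1 : u ≤ 1 := iSup_le fun s => chainPr_le_one F
  have hle : ∀ s, chainPr k s F ≤ u := fun s => le_iSup (fun s => chainPr k s F) s
  have hD : ∀ s ∈ D, chainPr k s F ≤ ρ * u := by
    intro s hs
    obtain ⟨n, hn⟩ := h s hs
    refine (chainPr_evAlways_notMem_le hk hF hle n s).trans ?_
    gcongr
  have hfirst : ∀ n s, chainPr k s (F ∩ {ω | ω n ∈ D ∧ ∀ i < n, ω i ∉ D}) ≤
      firstHitProb k D n s * (ρ * u) := by
    intro n
    induction n with
    | zero =>
      intro s
      by_cases hs : s ∈ D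
      · simpa [firstHitProb, hs] using (chainPr_mono Set.inter_subset_left).trans (hD s hs)
      · rw [chainPr_mono_null (F := ∅) _ (by simp [chainPr])]
        · exact zero_le
        · rintro ω rfl ⟨-, h0, -⟩
          exact hs h0
    | succ n ih =>
      intro s
      by_cases hs : s ∈ D
      · rw [chainPr_mono_null (F := ∅) _ (by simp [chainPr])]
        · exact zero_le
        · rintro ω rfl ⟨-, -, h0⟩
          exact h0 0 (by omega) hs
      · rw [firstHitProb, if_neg hs, ← ENNReal.tsum_mul_right]
        refine (chainPr_step (kernel_ne_top hk) s _).trans (ENNReal.tsum_le_tsum fun t => ?_)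
        rw [mul_assoc]
        gcongr
        refine (chainPr_mono ?_).trans (ih t)
        rintro ω ⟨hω, h1, h2⟩
        exact ⟨(hF s ω hω).2, h1, fun i hi => h2 (i + 1) (by omega)⟩
  have hall : ∀ s, chainPr k s F ≤ ρ * u := by
    intro s
    have hcov : F ⊆ ⋃ n : ℕ, F ∩ {ω | ω n ∈ D ∧ ∀ i < n, ω i ∉ D} := by
      intro ω hω
      have hex : ∃ n, ω n ∈ D := by
        obtain ⟨i, -, hi⟩ := hω.1 0
        exact ⟨i, hi⟩
      exact Set.mem_iUnion.2 ⟨Nat.find hex, hω, Nat.find_spec hex, fun i hi => Nat.find_min hex hi⟩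
    calc chainPr k s F ≤ ∑' n, chainPr k s (F ∩ {ω | ω n ∈ D ∧ ∀ i < n, ω i ∉ D}) :=
          (chainPr_mono hcov).trans (chainPr_iUnion_le _)
      _ ≤ ∑' n, firstHitProb k D n s * (ρ * u) := ENNReal.tsum_le_tsum fun n => hfirst n s
      _ = (∑' n, firstHitProb k D n s) * (ρ * u) := ENNReal.tsum_mul_right
      _ ≤ 1 * (ρ * u) := by
          gcongr
          rw [ENNReal.tsum_eq_iSup_nat]
          exact iSup_le fun n => sum_firstHitProb_le_one hk D n s
      _ = ρ * u := one_mul _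
  have hu0 : u = 0 := by
    by_contra hne
    have h1 : u ≤ ρ * u := iSup_le hall
    have h2 : ρ * u < 1 * u :=
      ENNReal.mul_lt_mul_left hne (hu1.trans_lt ENNReal.one_lt_top).ne hρ
    rw [one_mul] at h2
    exact absurd h1 (not_le.2 h2)
  exact le_antisymm ((hle s).trans hu0.le) zero_le

omit [Countable S] in
/-- A successor from which `A` is reached bounds the probability of avoiding `A`. -/
theorem avoidProb_succ_add_le (hk : ∀ s, ∑' t, k s t = 1) {A : Set S} {n : ℕ} {c : ℝ≥0∞}
    (h : avoidProb k A n t + c ≤ 1) : avoidProb k A (n + 1) s + k s t * c ≤ 1 := by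
  have h1 : avoidProb k A (n + 1) s ≤ ∑' t, k s t * avoidProb k A n t := by
    rw [avoidProb]
    split_ifs
    · exact zero_le
    · exact le_rfl
  calc avoidProb k A (n + 1) s + k s t * c
      ≤ ∑' t, k s t * avoidProb k A n t + ∑' t', if t' = t then k s t * c else 0 := by
        rw [tsum_ite_eq]
        gcongr
    _ = ∑' t', (k s t' * avoidProb k A n t' + if t' = t then k s t * c else 0) :=
        ENNReal.tsum_add.symm
    _ ≤ ∑' t', k s t' := by
        refine ENNReal.tsum_le_tsum fun t' => ?_
        split_ifs with ht
        · subst ht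
          rw [← mul_add]
          simpa using mul_le_mul_right h (k s t')
        · simpa using mul_le_mul_right (avoidProb_le_one hk A n t') (k s t')
    _ = 1 := hk s

theorem chainPr_infOften_diff_null (hk : ∀ s, ∑' t, k s t = 1) {D A : Set S}
    {c : ℝ≥0∞} (hc : c ≠ 0) (h : ∀ s ∈ D, ∃ n, avoidProb k A n s + c ≤ 1) (s : S) :
    chainPr k s (evInfOften (· ∈ D) \ evInfOften (· ∈ A)) = 0 := by
  refine chainPr_not_infOften_null hk (chainPr_infOften_avoid_null hk
    (ENNReal.sub_lt_self ENNReal.one_ne_top one_ne_zero hc) fun s hs => ?_) s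
  obtain ⟨n, hn⟩ := h s hs
  exact ⟨n, ENNReal.le_sub_of_add_le_right
    ((le_add_self.trans hn).trans_lt ENNReal.one_lt_top).ne hn⟩

/-- Geometric drift towards a set forces the chain to enter it almost surely. -/
theorem chainPr_avoid_null_of_drift (hk : ∀ s, ∑' t, k s t = 1) {A : Set S} {V : S → ℝ≥0∞}
    {ρ : ℝ≥0∞} (hρ : ρ < 1) (hV : ∀ s, 1 ≤ V s) (hVtop : ∀ s, V s ≠ ∞)
    (hdrift : ∀ s ∉ A, ∑' t, k s t * V t ≤ ρ * V s) (s : S) :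
    chainPr k s (evAlways (· ∉ A)) = 0 := by
  have hle : ∀ n s, avoidProb k A n s ≤ ρ ^ n * V s := by
    intro n
    induction n with
    | zero =>
      intro s
      unfold avoidProb
      split_ifs
      · exact zero_le
      · simpa using hV s
    | succ n ih =>
      intro s
      unfold avoidProb
      split_ifs with hs
      · exact zero_le
      · calc ∑' t, k s t * avoidProb k A n t ≤ ∑' t, ρ ^ n * (k s t * V t) :=
              ENNReal.tsum_le_tsum fun t => by
                rw [mul_left_comm]
                gcongr
                exact ih t
          _ = ρ ^ n * ∑' t, k s t * V t := ENNReal.tsum_mul_left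
          _ ≤ ρ ^ n * (ρ * V s) := by gcongr; exact hdrift s hs
          _ = ρ ^ (n + 1) * V s := by rw [pow_succ, mul_assoc]
  have hlim : Filter.Tendsto (fun n => ρ ^ n * V s) Filter.atTop (nhds 0) := by
    rw [← zero_mul (V s)]
    exact ENNReal.Tendsto.mul_const (ENNReal.tendsto_pow_atTop_nhds_zero_of_lt_one hρ)
      (Or.inr (hVtop s))
  refine le_antisymm (ge_of_tendsto' hlim fun n => ?_) zero_le
  refine (chainPr_evAlways_notMem_le hk (A := A) (u := 1) ?_ (fun s => chainPr_le_one _) n s).trans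
    (by simpa using hle n s)
  exact fun s ω hω => ⟨hω 0, fun i => hω (i + 1)⟩

/-- If `◇A` holds almost surely in `s ∉ A`, it does so in every successor of `s`. -/
theorem chainPr_evEventually_successor (hk : ∀ s, ∑' t, k s t = 1) {A : Set S}
    (hs : s ∉ A) (h1 : chainPr k s (evEventually (· ∈ A)) = 1) (ht : k s t ≠ 0) :
    chainPr k t (evEventually (· ∈ A)) = 1 := by
  set u : S → ℝ≥0∞ := fun t => chainPr k t (evEventually (· ∈ A)) with hu
  have hle : ∀ t, u t ≤ 1 := fun t => chainPr_le_one _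
  have h2 : 1 ≤ ∑' t, k s t * u t := by
    rw [← h1]
    refine (chainPr_step (kernel_ne_top hk) s _).trans (ENNReal.tsum_le_tsum fun t => ?_)
    gcongr
    refine chainPr_mono ?_
    rintro ω ⟨i, hi⟩
    cases i with
    | zero => exact absurd hi hs
    | succ i => exact ⟨i, hi⟩
  have h3 : ∑' t, k s t * u t + ∑' t, k s t * (1 - u t) = 1 := by
    rw [← ENNReal.tsum_add]
    refine Eq.trans ?_ (hk s)
    refine tsum_congr fun t => ?_
    rw [← mul_add, add_tsub_cancel_of_le (hle t), mul_one]
  have h4 : ∑' t, k s t * (1 - u t) = 0 := by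
    by_contra hne
    have h5 := ENNReal.lt_add_right (a := 1) ENNReal.one_ne_top hne
    exact absurd h3 (ne_of_gt (h5.trans_le (by gcongr)))
  have h6 := ENNReal.tsum_eq_zero.1 h4 t
  rcases mul_eq_zero.1 h6 with h6 | h6
  · exact absurd h6 ht
  · exact le_antisymm (hle t) (tsub_eq_zero_iff_le.1 h6)

/-- If `◇A` has positive probability, then `A` is reachable through transitions of positive
probability. -/
theorem exists_reach_of_chainPr_ne_zero (hk : ∀ s, ∑' t, k s t = 1) {A : Set S}
    (h : chainPr k s (evEventually (· ∈ A)) ≠ 0) :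
    ∃ t ∈ A, Relation.ReflTransGen (fun a b => k a b ≠ 0 ∧ a ∉ A) s t := by
  contrapose! h
  have key : ∀ n s, (∀ t ∈ A, ¬ Relation.ReflTransGen (fun a b => k a b ≠ 0 ∧ a ∉ A) s t) →
      chainPr k s {ω | ω n ∈ A} = 0 := by
    intro n
    induction n with
    | zero =>
      intro s hs
      refine chainPr_mono_null (F := ∅) ?_ (by simp [chainPr])
      rintro ω rfl hω
      exact hs _ hω .refl
    | succ n ih =>
      intro s hs
      refine le_antisymm ((chainPr_step (kernel_ne_top hk) s _).trans ?_) zero_le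
      refine (ENNReal.tsum_eq_zero.2 fun t => ?_).le
      by_cases ht : k s t = 0
      · simp [ht]
      · have := ih t fun t' ht' hr => hs t' ht' (.head ⟨ht, fun hsA => hs s hsA .refl⟩ hr)
        rw [← mul_zero (k s t), ← this]
        rfl
  refine chainPr_mono_null ?_ (chainPr_iUnion_null fun n => key n s h)
  rintro ω - ⟨n, hn⟩
  exact Set.mem_iUnion.2 ⟨n, hn⟩

/-- Among finitely many properties, one holds infinitely often if their disjunction does. -/
theorem exists_mem_evInfOften {α ι : Type*} [Finite ι] {P : ι → α → Prop} {ω : ℕ → α}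
    (h : ∀ n, ∃ i, n ≤ i ∧ ∃ j, P j (ω i)) : ∃ j, ∀ n, ∃ i, n ≤ i ∧ P j (ω i) := by
  by_contra! hcon
  choose n hn using hcon
  obtain ⟨m, hm⟩ := Set.finite_range n |>.bddAbove
  obtain ⟨i, hi, j, hj⟩ := h m
  exact hn j i ((hm ⟨j, rfl⟩).trans hi) hj

end ChainLemmas

/-! ## Message losses -/

section Loss

omit [DecidableEq C] [Fintype C] in
theorem countEmb_ne_zero_iff (v w : List M) : countEmb v w ≠ 0 ↔ w.Sublist v := by
  induction v generalizing w with
  | nil => cases w <;> simp [countEmb]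
  | cons a v ih =>
    cases w with
    | nil => simp [countEmb]
    | cons b w =>
      rw [countEmb, List.sublist_cons_iff, ← ih (b :: w)]
      by_cases h : a = b
      · subst h
        have : (∃ r, a :: w = a :: r ∧ r.Sublist v) ↔ w.Sublist v := by simp
        rw [this, ← ih w, if_pos rfl]
        omega
      · simp [h, Ne.symm h]

omit [DecidableEq C] [Fintype C] in
/-- Generating function of the number of messages surviving in one channel. -/
theorem tsum_countEmb (T R : ℝ≥0∞) (v : List M) :
    ∑' w : List M, T ^ (v.length - w.length) * R ^ w.length * (countEmb v w : ℝ≥0∞) =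
      (T + R) ^ v.length := by
  induction v with
  | nil =>
    rw [tsum_eq_single []]
    · simp [countEmb]
    · intro w hw
      cases w with
      | nil => exact absurd rfl hw
      | cons b w => simp [countEmb]
  | cons a v ih =>
    set g : List M → ℝ≥0∞ :=
      fun w => T ^ (v.length - w.length) * R ^ w.length * (countEmb v w : ℝ≥0∞) with hg
    set h : List M → ℝ≥0∞ := fun w => match w with
      | [] => 0
      | b :: w => if a = b then R * g w else 0 with hh
    have hsplit : ∀ w : List M, T ^ ((a :: v).length - w.length) * R ^ w.length *
        (countEmb (a :: v) w : ℝ≥0∞) = T * g w + h w := by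
      intro w
      cases w with
      | nil => simp [hg, hh, countEmb, pow_succ']
      | cons b w =>
        have h1 : T ^ (v.length - w.length) * (countEmb v (b :: w) : ℝ≥0∞) =
            T * T ^ (v.length - (w.length + 1)) * (countEmb v (b :: w) : ℝ≥0∞) := by
          by_cases h0 : countEmb v (b :: w) = 0
          · simp [h0]
          · have := ((countEmb_ne_zero_iff _ _).1 h0).length_le
            rw [List.length_cons] at this
            rw [← pow_succ']
            congr 2
            omega
        simp only [hg, hh, countEmb, List.length_cons, Nat.add_sub_add_right]
        push_cast
        rw [mul_add, mul_right_comm _ _ (countEmb v (b :: w) : ℝ≥0∞), h1]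
        split_ifs
        · ring
        · ring
    have hinj : Function.Injective (fun w : List M => a :: w) := List.cons_injective
    have hsum : ∑' w, h w = R * ∑' w, g w := by
      rw [← hinj.tsum_eq, ← ENNReal.tsum_mul_left]
      · simp [hh]
      · intro w hw
        cases w with
        | nil => simp [hh] at hw
        | cons b w =>
          by_cases hab : a = b
          · exact ⟨w, by simp [hab]⟩
          · simp [hh, hab] at hw
    calc _ = ∑' w, (T * g w + h w) := tsum_congr hsplit
      _ = T * ∑' w, g w + R * ∑' w, g w := by
          rw [ENNReal.tsum_add, ENNReal.tsum_mul_left, hsum]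
      _ = _ := by rw [ih, List.length_cons, pow_succ']; ring

omit [DecidableEq M] in
theorem tsum_pi_prod (f : C → List M → ℝ≥0∞) (t : C → Finset (List M))
    (hf : ∀ c, ∀ w ∉ t c, f c w = 0) :
    ∑' p : Chans C M, ∏ c, f c (p c) = ∏ c, ∑' w, f c w := by
  rw [Finset.prod_congr rfl fun c _ => tsum_eq_sum (s := t c) (hf c), Finset.prod_univ_sum,
    tsum_eq_sum]
  intro p hp
  rw [Fintype.mem_piFinset] at hp
  push Not at hp
  obtain ⟨c, hc⟩ := hp
  exact Finset.prod_eq_zero (Finset.mem_univ c) (hf c _ hc)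

omit [DecidableEq C] in
theorem plost_eq_prod {τ : ℝ} (h0 : 0 < τ) (h1 : τ < 1) (v w : Chans C M) :
    plost τ v w = ∏ c, (ENNReal.ofReal τ ^ ((v c).length - (w c).length) *
      ENNReal.ofReal (1 - τ) ^ (w c).length * (countEmb (v c) (w c) : ℝ≥0∞)) := by
  rw [plost, ENNReal.ofReal_mul (by have := sub_pos.2 h1; positivity),
    ENNReal.ofReal_mul (by positivity), ENNReal.ofReal_pow h0.le,
    ENNReal.ofReal_pow (sub_pos.2 h1).le, ENNReal.ofReal_natCast]
  push_cast
  by_cases h : ∀ c, countEmb (v c) (w c) ≠ 0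
  · rw [Finset.prod_mul_distrib, Finset.prod_mul_distrib, Finset.prod_pow_eq_pow_sum,
      Finset.prod_pow_eq_pow_sum, Finset.sum_tsub_distrib]
    · rfl
    · exact fun c _ => ((countEmb_ne_zero_iff _ _).1 (h c)).length_le
  · push Not at h
    obtain ⟨c, hc⟩ := h
    rw [Finset.prod_eq_zero (Finset.mem_univ c) (by simp [hc]), mul_zero,
      Finset.prod_eq_zero (Finset.mem_univ c) (by simp [hc])]

/-- Generating function of the number of messages surviving. -/
theorem tsum_plost_mul_pow {τ : ℝ} (h0 : 0 < τ) (h1 : τ < 1) (a : ℝ≥0∞) (v : Chans C M) :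
    ∑' w, plost τ v w * a ^ chansSize w =
      (ENNReal.ofReal τ + ENNReal.ofReal (1 - τ) * a) ^ chansSize v := by
  have hprod : ∀ w : Chans C M, plost τ v w * a ^ chansSize w =
      ∏ c, (ENNReal.ofReal τ ^ ((v c).length - (w c).length) *
        (ENNReal.ofReal (1 - τ) * a) ^ (w c).length * (countEmb (v c) (w c) : ℝ≥0∞)) := by
    intro w
    rw [plost_eq_prod h0 h1, chansSize, ← Finset.prod_pow_eq_pow_sum, ← Finset.prod_mul_distrib]
    refine Finset.prod_congr rfl fun c _ => ?_
    rw [mul_pow]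
    ring
  rw [tsum_congr hprod, tsum_pi_prod (fun c u => ENNReal.ofReal τ ^ ((v c).length - u.length) *
        (ENNReal.ofReal (1 - τ) * a) ^ u.length * (countEmb (v c) u : ℝ≥0∞))
      (fun c => (v c).sublists.toFinset)]
  · simp_rw [tsum_countEmb]
    rw [Finset.prod_pow_eq_pow_sum]
    rfl
  · intro c u hu
    have : countEmb (v c) u = 0 := by
      by_contra h
      exact hu (by simpa using (countEmb_ne_zero_iff _ _).1 h)
    simp [this]

theorem tsum_plost {τ : ℝ} (h0 : 0 < τ) (h1 : τ < 1) (v : Chans C M) :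
    ∑' w, plost τ v w = 1 := by
  have h := tsum_plost_mul_pow h0 h1 1 v
  rw [mul_one, ← ENNReal.ofReal_add h0.le (sub_pos.2 h1).le] at h
  simpa using h

omit [DecidableEq C] in
theorem plost_ne_zero_iff {τ : ℝ} (h0 : 0 < τ) (h1 : τ < 1) (v w : Chans C M) :
    plost τ v w ≠ 0 ↔ ∀ c, (w c).Sublist (v c) := by
  rw [plost_eq_prod h0 h1, Finset.prod_ne_zero_iff]
  refine ⟨fun h c => (countEmb_ne_zero_iff _ _).1 fun hc => h c (Finset.mem_univ c) (by simp [hc]),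
    fun h c _ => ?_⟩
  refine mul_ne_zero (mul_ne_zero (pow_ne_zero _ ?_) (pow_ne_zero _ ?_)) ?_
  · simpa using h0
  · simpa using h1
  · exact_mod_cast (countEmb_ne_zero_iff _ _).2 (h c)

omit [DecidableEq C] in
theorem plost_eps {τ : ℝ} (h0 : 0 < τ) (v : Chans C M) :
    plost τ v (eps C M) = ENNReal.ofReal τ ^ chansSize v := by
  have : ∀ l : List M, countEmb l [] = 1 := fun l => by cases l <;> rfl
  simp [plost, eps, chansSize, this, ENNReal.ofReal_pow h0.le]

omit [DecidableEq M] in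
theorem chansSize_applyOp_le (o : LcsOp C M) (w : Chans C M) :
    chansSize (applyOp o w) ≤ chansSize w + 1 := by
  have key : ∀ (c : C) (u : List M), u.length ≤ (w c).length + 1 →
      chansSize (Function.update w c u) ≤ chansSize w + 1 := by
    intro c u hu
    unfold chansSize
    rw [← Finset.add_sum_erase _ _ (Finset.mem_univ c),
      ← Finset.add_sum_erase Finset.univ (fun c => (w c).length) (Finset.mem_univ c),
      Finset.sum_congr rfl (g := fun c => (w c).length)]
    · simp only [Function.update_self]
      omega
    · intro d hd
      rw [Function.update_of_ne (Finset.ne_of_mem_erase hd)]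
  cases o with
  | send c m => exact key c _ (by simp)
  | recv c m => exact key c _ (by simp; omega)
  | internal => exact Nat.le_succ _

end Loss

/-! ## The Markov chain of a scheduler -/

section SchedulerLemmas

theorem stepProb_ne_zero_iff (s t : Conf Q C M) (δ : LcsRule Q C M) :
    N.stepProb s δ t ≠ 0 ↔ N.L.StepVia s δ t := by
  unfold NPLCS.stepProb LCS.StepVia
  split_ifs with h
  · rw [plost_ne_zero_iff N.τ_pos N.τ_lt_one]
    tauto
  · simp only [ne_eq, not_true_eq_false, false_iff]
    tauto

theorem Scheduler.kernel_ne_zero_iff (U : Scheduler N) (a b : List (Conf Q C M) × Conf Q C M) :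
    U.kernel a b ≠ 0 ↔ b.1 = a.1 ++ [a.2] ∧ N.L.StepVia a.2 (U.choose a.1 a.2) b.2 := by
  unfold Scheduler.kernel
  split_ifs with h
  · simp only [stepProb_ne_zero_iff, h, true_and]
  · simp [h]

theorem Scheduler.kernel_succ (U : Scheduler N) (h : List (Conf Q C M)) (s : Conf Q C M)
    (w : Chans C M) :
    U.kernel (h, s) (h ++ [s], ((U.choose h s).dst, w)) =
      plost N.τ (applyOp (U.choose h s).op s.2) w := by
  simp [Scheduler.kernel, NPLCS.stepProb, U.choose_mem, U.choose_enabled]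

theorem Scheduler.tsum_kernel_mul (U : Scheduler N) (a : List (Conf Q C M) × Conf Q C M)
    (g : List (Conf Q C M) × Conf Q C M → ℝ≥0∞) :
    ∑' b, U.kernel a b * g b = ∑' w, plost N.τ (applyOp (U.choose a.1 a.2).op a.2.2) w *
      g (a.1 ++ [a.2], ((U.choose a.1 a.2).dst, w)) := by
  obtain ⟨h, s⟩ := a
  have hinj : Function.Injective
      (fun w : Chans C M => (h ++ [s], ((U.choose h s).dst, w))) := by
    intro w w' hw
    simpa using hw
  rw [← hinj.tsum_eq]
  · exact tsum_congr fun w => by rw [U.kernel_succ]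
  · rintro ⟨h', p, w⟩ hb
    obtain ⟨h1, -, -, h2, -⟩ := (U.kernel_ne_zero_iff _ _).1 (left_ne_zero_of_mul hb)
    exact ⟨w, by simp_all⟩

theorem Scheduler.tsum_kernel (U : Scheduler N) (a : List (Conf Q C M) × Conf Q C M) :
    ∑' b, U.kernel a b = 1 := by
  have := U.tsum_kernel_mul a fun _ => 1
  simpa [tsum_plost N.τ_pos N.τ_lt_one] using this

variable [Finite Q] [Finite M]

theorem exists_drift_threshold {τ : ℝ} (h0 : 0 < τ) (h1 : τ < 1) :
    ∃ K : ℕ, ∀ n, K ≤ n →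
      (ENNReal.ofReal τ + ENNReal.ofReal (1 - τ) * 2) ^ (n + 1) ≤ 2⁻¹ * (2 : ℝ≥0∞) ^ n := by
  obtain ⟨K, hK⟩ := exists_pow_lt_of_lt_one (show (0 : ℝ) < 1 / 4 by norm_num)
    (show (2 - τ) / 2 < 1 by linarith)
  refine ⟨K, fun n hn => ?_⟩
  have hr : (2 - τ) ^ (n + 1) ≤ 2⁻¹ * 2 ^ n := by
    have hp : ((2 - τ) / 2) ^ n ≤ 1 / 4 :=
      (pow_le_pow_of_le_one (by linarith) (by linarith) hn).trans hK.le
    have hq : (2 - τ) ^ n = ((2 - τ) / 2) ^ n * 2 ^ n := by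
      rw [← mul_pow]
      congr 1
      ring
    rw [pow_succ, hq]
    have : (0 : ℝ) < 2 ^ n := by positivity
    have h3 : ((2 - τ) / 2) ^ n * (2 - τ) ≤ 1 / 4 * 2 :=
      mul_le_mul hp (by linarith) (by linarith) (by norm_num)
    nlinarith
  have hb : ENNReal.ofReal τ + ENNReal.ofReal (1 - τ) * 2 = ENNReal.ofReal (2 - τ) := by
    rw [show (2 : ℝ≥0∞) = ENNReal.ofReal 2 by simp, ← ENNReal.ofReal_mul (by linarith),
      ← ENNReal.ofReal_add h0.le (by linarith)]
    congr 1
    ring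
  rw [hb, ← ENNReal.ofReal_pow (by linarith)]
  refine (ENNReal.ofReal_le_ofReal hr).trans ?_
  rw [ENNReal.ofReal_mul (by norm_num), ENNReal.ofReal_pow (by norm_num),
    ENNReal.ofReal_inv_of_pos (by norm_num)]
  simp

/-- The configurations with empty channels form an attractor. -/
theorem Scheduler.eps_attractor (U : Scheduler N) (a : List (Conf Q C M) × Conf Q C M) :
    chainPr U.kernel a (evInfOften (fun b => b.2.2 = eps C M))ᶜ = 0 := by
  obtain ⟨K, hK⟩ := exists_drift_threshold N.τ_pos N.τ_lt_one
  set small : Set (List (Conf Q C M) × Conf Q C M) := {b | chansSize b.2.2 < K} with hsmall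
  have h1 : ∀ a, chainPr U.kernel a (evAlways (· ∉ small)) = 0 := by
    refine chainPr_avoid_null_of_drift U.tsum_kernel (V := fun b => 2 ^ chansSize b.2.2)
      (ρ := 2⁻¹) (by norm_num) (fun b => one_le_pow₀ (by norm_num)) (fun b => by simp) ?_
    intro b hb
    rw [U.tsum_kernel_mul b, tsum_plost_mul_pow N.τ_pos N.τ_lt_one]
    refine le_trans ?_ (hK (chansSize b.2.2) (not_lt.1 hb))
    refine pow_le_pow_right₀ ?_ (chansSize_applyOp_le _ _)
    calc (1 : ℝ≥0∞) = ENNReal.ofReal N.τ + ENNReal.ofReal (1 - N.τ) * 1 := by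
          rw [mul_one, ← ENNReal.ofReal_add N.τ_pos.le (sub_pos.2 N.τ_lt_one).le]
          simp
      _ ≤ _ := by gcongr; norm_num
  have h2 := chainPr_not_infOften_null U.tsum_kernel (D := Set.univ)
    (fun s => chainPr_mono_null (fun ω _ hω => hω.2) (h1 s)) a
  have h3 := chainPr_infOften_diff_null U.tsum_kernel (D := small)
    (A := {b | b.2.2 = eps C M}) (c := ENNReal.ofReal N.τ ^ K)
    (pow_ne_zero _ (by simpa using N.τ_pos)) (fun b hb => by
      refine ⟨1, ?_⟩
      have h4 := avoidProb_succ_add_le U.tsum_kernel (s := b) (n := 0) (c := 1)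
        (t := (b.1 ++ [b.2], ((U.choose b.1 b.2).dst, eps C M)))
        (A := {b | b.2.2 = eps C M}) (by simp [avoidProb])
      rw [mul_one, U.kernel_succ b.1 b.2, plost_eps N.τ_pos] at h4
      refine le_trans ?_ h4
      gcongr ?_ + ?_
      · exact le_rfl
      · refine pow_le_pow_of_le_one zero_le ?_ ((chansSize_applyOp_le _ _).trans hb)
        simpa using N.τ_lt_one.le) a
  refine chainPr_mono_null ?_ (chainPr_union_null h2 h3)
  intro ω _ hω
  by_cases hs : ω ∈ evInfOften (· ∈ small)
  · exact Or.inr ⟨hs, hω⟩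
  · exact Or.inl ⟨fun n => ⟨n, le_rfl, trivial⟩, hs⟩

omit [Finite Q] [Finite M] [Fintype C] [DecidableEq M] in
theorem stepVia_of_eps {L : LCS Q C M} {x : Q} {δ : LcsRule Q C M} {t : Conf Q C M}
    (h : L.StepVia (x, eps C M) δ t) (w : Chans C M) :
    ¬ δ.op.IsRecv ∧ L.StepVia (x, w) δ t := by
  obtain ⟨h1, ⟨h2, h3⟩, h4, h5⟩ := h
  unfold LCS.StepVia LcsRule.EnabledIn
  cases hop : δ.op with
  | recv c m =>
    rw [hop] at h3
    obtain ⟨v, hv⟩ := h3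
    simp [eps] at hv
  | send c m =>
    rw [hop] at h5
    refine ⟨id, h1, ⟨h2, trivial⟩, h4, fun d => (h5 d).trans ?_⟩
    by_cases hd : d = c
    · subst hd; simp [applyOp, eps]
    · simp [applyOp, hd, eps]
  | internal =>
    rw [hop] at h5
    exact ⟨id, h1, ⟨h2, trivial⟩, h4, fun d => (h5 d).trans (by simp [applyOp, eps])⟩

omit [Finite Q] [Finite M] [Fintype C] [DecidableEq M] in
theorem isSafeFor_safe (L : LCS Q C M) (A : Set Q) : L.IsSafeFor A (L.Safe A) := by
  refine ⟨Set.sUnion_subset fun X hX => hX.1, ?_⟩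
  rintro x ⟨X, hX, hx⟩
  obtain ⟨t, ht, htX⟩ := hX.2 x hx
  exact ⟨t, ht, X, hX, htX⟩

/-- A scheduler that almost surely ends up in one of the `B i` almost surely visits one of the
sets `Safe (B i)`. -/
theorem Scheduler.pr_evEventually_safe {ι : Type*} {B : ι → Set Q} (U : Scheduler N)
    (s : Conf Q C M) (hU : U.Pr s (⋃ i, evEvAlways (inLoc (B i))) = 1) :
    U.Pr s (evEventually (inLoc (⋃ i, N.L.Safe (B i)))) = 1 := by
  have : Finite N.L.rules := N.L.finiteRules
  set D : Q × N.L.rules → Set (List (Conf Q C M) × Conf Q C M) :=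
    fun p => {b | b.2 = (p.1, eps C M) ∧ U.choose b.1 b.2 = p.2} with hD
  set A : Q × N.L.rules → Set (List (Conf Q C M) × Conf Q C M) :=
    fun p => {b | b.2 = (p.2.1.dst, eps C M)} with hA
  have hDA : ∀ p, chainPr U.kernel ([], s) (evInfOften (· ∈ D p) \ evInfOften (· ∈ A p)) = 0 := by
    intro p
    refine chainPr_infOften_diff_null U.tsum_kernel
      (c := plost N.τ (applyOp p.2.1.op (eps C M)) (eps C M)) ?_ ?_ _
    · rw [plost_ne_zero_iff N.τ_pos N.τ_lt_one]
      exact fun c => List.nil_sublist _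
    · rintro ⟨h, s⟩ ⟨rfl, hb⟩
      refine ⟨1, ?_⟩
      have h4 := avoidProb_succ_add_le U.tsum_kernel (s := (h, (p.1, eps C M))) (n := 0) (c := 1)
        (t := (h ++ [(p.1, eps C M)], ((U.choose h (p.1, eps C M)).dst, eps C M)))
        (A := A p) (by
          rw [avoidProb, if_pos, zero_add]
          rw [hb]
          rfl)
      rw [mul_one, U.kernel_succ] at h4
      dsimp only at hb h4
      rwa [hb] at h4
  refine chainPr_eq_one_of_diff_null hU (chainPr_mono_null ?_ 
    (chainPr_union_null (U.eps_attractor ([], s)) (chainPr_iUnion_null hDA)))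
  rintro ω - ⟨hω, hnot⟩
  by_contra hcon
  rw [Set.mem_union, not_or, Set.mem_compl_iff, not_not, Set.mem_iUnion] at hcon
  obtain ⟨heps, hcon⟩ := hcon
  obtain ⟨i, n, hn⟩ := Set.mem_iUnion.1 hω
  set X : Set Q := {x | ω ∈ evInfOften (fun b => b.2 = (x, eps C M))} with hX
  have hXB : X ⊆ B i := by
    intro x hx
    obtain ⟨j, hj, hjx⟩ := hx n
    have : (ω j).2.1 ∈ B i := hn j hj
    rwa [hjx] at this
  have hsafe : N.L.IsSafeFor (B i) X := by
    refine ⟨hXB, fun x hx => ?_⟩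
    obtain ⟨δ, hδ⟩ := exists_mem_evInfOften (ι := N.L.rules)
      (P := fun δ b => b ∈ D (x, δ)) (ω := ω) (fun n => by
        obtain ⟨j, hj, hjx⟩ := hx n
        exact ⟨j, hj, ⟨_, U.choose_mem _ _⟩, hjx, rfl⟩)
    have hδA : ω ∈ evInfOften (· ∈ A (x, δ)) := by
      by_contra hno
      exact hcon ⟨(x, δ), hδ, hno⟩
    refine ⟨(δ.1.dst, eps C M), ⟨δ.1, δ.2, ?_, rfl, fun c => List.nil_sublist _⟩, hδA⟩
    obtain ⟨j, -, hj1, hj2⟩ := hδ 0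
    have := U.choose_enabled (ω j).1 (ω j).2
    rwa [hj2, hj1] at this
  obtain ⟨x, hx⟩ := exists_mem_evInfOften (ι := Q)
    (P := fun x (b : List (Conf Q C M) × Conf Q C M) => b.2 = (x, eps C M)) (ω := ω) (fun n => by
      obtain ⟨j, hj, hjx⟩ := heps n
      exact ⟨j, hj, (ω j).2.1, Prod.ext rfl hjx⟩)
  obtain ⟨j, -, hj⟩ := hx 0
  refine hnot ⟨j, Set.mem_iUnion.2 ⟨i, X, hsafe, ?_⟩⟩
  change (ω j).2.1 ∈ X
  rw [hj]
  exact hx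

/-- If `A` is almost surely reached from `(q, ε)`, then `q` belongs to `A` or to a set promising
for `A`. -/
theorem Scheduler.exists_isPromisingFor {A : Set Q} {q : Q} (V : Scheduler N)
    (hV : V.Pr (q, eps C M) (evEventually (inLoc A)) = 1) :
    ∃ X : Set Q, N.L.IsPromisingFor A X ∧ (q ∈ A ∨ q ∈ X) := by
  set A' : Set (List (Conf Q C M) × Conf Q C M) := {b | b.2.1 ∈ A} with hA'
  set R : List (Conf Q C M) × Conf Q C M → List (Conf Q C M) × Conf Q C M → Prop :=
    fun a b => V.kernel a b ≠ 0 ∧ a ∉ A' with hR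
  set X : Set Q :=
    {x | x ∉ A ∧ ∃ b, Relation.ReflTransGen R ([], (q, eps C M)) b ∧ b.2.1 = x} with hX
  refine ⟨X, ?_, (Classical.em (q ∈ A)).imp_right fun hq => ⟨hq, _, .refl, rfl⟩⟩
  have hsure : ∀ b, Relation.ReflTransGen R ([], (q, eps C M)) b →
      chainPr V.kernel b (evEventually (· ∈ A')) = 1 := by
    intro b hb
    induction hb with
    | refl => exact hV
    | tail _ hab ih => exact chainPr_evEventually_successor V.tsum_kernel hab.2 ih hab.1
  rintro _ ⟨hxA, b, hb, rfl⟩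
  have hb' : Relation.ReflTransGen R ([], (q, eps C M)) (b.1, (b.2.1, eps C M)) := by
    cases hb with
    | refl => exact .refl
    | tail hb hab =>
      refine hb.tail ⟨?_, hab.2⟩
      obtain ⟨h1, h2, h3, h4, -⟩ := (V.kernel_ne_zero_iff _ _).1 hab.1
      exact (V.kernel_ne_zero_iff _ _).2 ⟨h1, h2, h3, h4, fun c => List.nil_sublist _⟩
  obtain ⟨t, htA, ht⟩ := exists_reach_of_chainPr_ne_zero V.tsum_kernel (A := A')
    (by rw [hsure _ hb']; exact one_ne_zero)
  refine ⟨t.2, ?_, htA⟩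
  clear htA
  induction ht with
  | refl => exact .refl
  | tail hc hcd ih =>
    exact ih.tail ⟨⟨_, ((V.kernel_ne_zero_iff _ _).1 hcd.1).2⟩, hcd.2, _, hb'.trans hc, rfl⟩

/-- `A` can be reached from `s` in `n` steps within `X`. -/
def LCS.ReachIn (L : LCS Q C M) (A X : Set Q) : ℕ → Conf Q C M → Prop
  | 0, s => s.1 ∈ A
  | n + 1, s => s.1 ∈ X ∧ ∃ δ t, L.StepVia s δ t ∧ LCS.ReachIn L A X n t

omit [Finite Q] [Finite M] [Fintype C] [DecidableEq M] in
theorem LCS.IsPromisingFor.exists_reachIn {L : LCS Q C M} {A X : Set Q}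
    (hX : L.IsPromisingFor A X) {s : Conf Q C M} (hs : s.1 ∈ X) : ∃ n, L.ReachIn A X n s := by
  obtain ⟨x, w⟩ := s
  have key : ∀ s t, L.ReachWithin X s t → t.1 ∈ A → ∃ n, L.ReachIn A X n s := by
    intro s t hst ht
    induction hst using Relation.ReflTransGen.head_induction_on with
    | refl => exact ⟨0, ht⟩
    | head hab _ ih =>
      obtain ⟨⟨δ, hδ⟩, haX⟩ := hab
      obtain ⟨n, hn⟩ := ih
      exact ⟨n + 1, haX, δ, _, hδ, hn⟩
  obtain ⟨t, hr, ht⟩ := hX x hs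
  rcases Relation.ReflTransGen.cases_head hr with rfl | ⟨u, ⟨⟨δ, hδ⟩, -⟩, hut⟩
  · exact ⟨0, ht⟩
  · obtain ⟨n, hn⟩ := key u t hut ht
    exact ⟨n + 1, hs, δ, u, (stepVia_of_eps hδ w).2, hn⟩

omit [Finite Q] [Finite M] [Fintype C] [DecidableEq M] in
/-- A promising set admits steps that decrease the distance to the target. -/
theorem LCS.IsPromisingFor.exists_rank {L : LCS Q C M} {A X : Set Q}
    (hX : L.IsPromisingFor A X) :
    ∃ rk : Conf Q C M → ℕ, ∀ s : Conf Q C M, s.1 ∈ X → s.1 ∉ A →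
      ∃ δ t, L.StepVia s δ t ∧ rk t < rk s ∧ (t.1 ∈ X ∨ t.1 ∈ A) := by
  refine ⟨fun s => sInf {n | L.ReachIn A X n s}, fun s hs hsA => ?_⟩
  have hmem : L.ReachIn A X (sInf {n | L.ReachIn A X n s}) s := Nat.sInf_mem (hX.exists_reachIn hs)
  rcases hn : sInf {n | L.ReachIn A X n s} with _ | n
  · rw [hn] at hmem
    exact absurd hmem hsA
  · rw [hn] at hmem
    obtain ⟨-, δ, t, hδ, ht⟩ := hmem
    refine ⟨δ, t, hδ, ?_, ?_⟩
    · change sInf _ < sInf _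
      rw [hn]
      exact Nat.lt_succ_of_le (Nat.sInf_le ht)
    cases n with
    | zero => exact Or.inr ht
    | succ n => exact Or.inl ht.1

omit [Finite Q] [Finite M] [Fintype C] [DecidableEq M] in
/-- Blind rules that stay forever in the union of the safe sets without increasing an index. -/
theorem exists_safe_rules (L : LCS Q C M) {n : ℕ} (B : Fin n → Set Q) :
    ∃ (β : Q → LcsRule Q C M) (idx : Q → ℕ),
      (∀ x, β x ∈ L.rules ∧ (β x).src = x ∧ ¬ (β x).op.IsRecv) ∧
      ∀ x ∈ ⋃ i, L.Safe (B i), (β x).dst ∈ ⋃ i, L.Safe (B i) ∧ idx (β x).dst ≤ idx x ∧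
        ∃ i : Fin n, i.val = idx x ∧ x ∈ L.Safe (B i) := by
  set J : Q → Set ℕ := fun x => {j | ∃ i : Fin n, i.val = j ∧ x ∈ L.Safe (B i)} with hJ
  have hrule : ∀ x, ∃ δ, (δ ∈ L.rules ∧ δ.src = x ∧ ¬ δ.op.IsRecv) ∧
      (x ∈ ⋃ i, L.Safe (B i) → ∃ i : Fin n, i.val = sInf (J x) ∧ x ∈ L.Safe (B i) ∧
        δ.dst ∈ L.Safe (B i)) := by
    intro x
    by_cases hx : x ∈ ⋃ i, L.Safe (B i)
    · obtain ⟨i, hi⟩ := Set.mem_iUnion.1 hx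
      obtain ⟨j, hj, hxj⟩ := Nat.sInf_mem (s := J x) ⟨_, i, rfl, hi⟩
      obtain ⟨t, ⟨δ, hδ⟩, ht⟩ := (isSafeFor_safe L (B j)).2 x hxj
      refine ⟨δ, ⟨hδ.1, hδ.2.1.1, (stepVia_of_eps hδ (eps C M)).1⟩, fun _ => ⟨j, hj, hxj, ?_⟩⟩
      rw [← hδ.2.2.1]
      exact ht
    · obtain ⟨δ, h1, h2, h3⟩ := L.noDeadlock x
      exact ⟨δ, ⟨h1, h2, h3⟩, fun h => absurd h hx⟩
  choose β hβ hβ' using hrule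
  refine ⟨β, fun x => sInf (J x), hβ, fun x hx => ?_⟩
  obtain ⟨i, hi, hxi, hd⟩ := hβ' x hx
  have hle : sInf (J (β x).dst) ≤ i.val := Nat.sInf_le ⟨i, rfl, hd⟩
  exact ⟨Set.mem_iUnion.2 ⟨i, hd⟩, hle.trans hi.le, i, hi, hxi⟩

omit [Finite Q] [Finite M] [Fintype C] [DecidableEq M] [DecidableEq C] in
theorem enabledIn_of_not_isRecv {δ : LcsRule Q C M} (h : ¬ δ.op.IsRecv) {s : Conf Q C M}
    (hs : δ.src = s.1) : δ.EnabledIn s := by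
  refine ⟨hs, ?_⟩
  cases hop : δ.op with
  | recv c m => rw [hop] at h; exact absurd trivial h
  | send c m => trivial
  | internal => trivial

omit [Finite Q] [Finite M] [Fintype C] [DecidableEq M] [DecidableEq C] in
theorem Scheduler.Memoryless.finiteMemory {U : Scheduler N} (hU : U.Memoryless) :
    U.FiniteMemory :=
  ⟨{ Mode := Unit
     modeFin := inferInstance
     init := ()
     D := fun _ s => U.choose [] s
     upd := fun _ _ => ()
     D_mem := fun _ s => U.choose_mem [] s
     D_enabled := fun _ s => U.choose_enabled [] s }, fun h s => hU h [] s⟩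

/-- Choosing rules that decrease a rank on a set of configurations ensures that this set is almost
surely left infinitely often. -/
theorem Scheduler.infOften_leave_of_rank (U : Scheduler N) {Z : Set (Conf Q C M)}
    (rk : Conf Q C M → ℕ)
    (hrk : ∀ s ∈ Z, ∃ δ t, (∀ h, U.choose h s = δ) ∧ N.L.StepVia s δ t ∧ rk t < rk s)
    (a : List (Conf Q C M) × Conf Q C M) :
    chainPr U.kernel a (evInfOften (fun b => b.2 ∉ Z))ᶜ = 0 := by
  set T : Set (List (Conf Q C M) × Conf Q C M) := {b | b.2 ∉ Z} with hT
  have hbound : ∀ s, ∃ m, ∃ c : ℝ≥0∞, c ≠ 0 ∧ ∀ h, avoidProb U.kernel T m (h, s) + c ≤ 1 := by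
    intro s
    induction hn : rk s using Nat.strong_induction_on generalizing s with
    | _ n ih =>
      by_cases hs : s ∈ Z
      · obtain ⟨δ, t, hδ, hst, hlt⟩ := hrk s hs
        obtain ⟨m, c, hc, hm⟩ := ih (rk t) (hn ▸ hlt) t rfl
        refine ⟨m + 1, N.stepProb s δ t * c, mul_ne_zero ?_ hc, fun h => ?_⟩
        · exact (stepProb_ne_zero_iff _ _ _).2 hst
        · have := avoidProb_succ_add_le U.tsum_kernel (s := (h, s)) (hm (h ++ [s]))
          simpa only [Scheduler.kernel, if_true, hδ] using this
      · exact ⟨0, 1, one_ne_zero, fun h => by simp [avoidProb, hT, hs]⟩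
  have hD : ∀ x : Q, chainPr U.kernel a
      (evInfOften (· ∈ {b | b.2 = (x, eps C M)}) \ evInfOften (· ∈ T)) = 0 := by
    intro x
    obtain ⟨m, c, hc, hm⟩ := hbound (x, eps C M)
    refine chainPr_infOften_diff_null U.tsum_kernel hc ?_ a
    rintro ⟨h, _⟩ rfl
    exact ⟨m, hm h⟩
  refine chainPr_mono_null ?_ 
    (chainPr_union_null (U.eps_attractor a) (chainPr_iUnion_null hD))
  intro ω _ hω
  by_contra hcon
  rw [Set.mem_union, not_or, Set.mem_compl_iff, not_not, Set.mem_iUnion] at hcon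
  obtain ⟨x, hx⟩ := exists_mem_evInfOften (ι := Q)
    (P := fun x (b : List (Conf Q C M) × Conf Q C M) => b.2 = (x, eps C M)) (ω := ω) (fun n => by
      obtain ⟨j, hj, hjx⟩ := hcon.1 n
      exact ⟨j, hj, (ω j).2.1, Prod.ext rfl hjx⟩)
  exact hcon.2 ⟨x, hx, hω⟩

omit [Finite Q] [Finite M] [Fintype C] [DecidableEq M] [DecidableEq C] in
/-- A sequence of locations that stays in `⋃ i, S i` without increasing the index is eventually
always in one of the `S i`. -/
theorem exists_eventually_mem {n : ℕ} {S : Fin n → Set Q} {idx : Q → ℕ} {loc : ℕ → Q} {m : ℕ}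
    (hidx : ∀ i, m ≤ i → idx (loc (i + 1)) ≤ idx (loc i))
    (hmem : ∀ i, m ≤ i → ∃ j : Fin n, j.val = idx (loc i) ∧ loc i ∈ S j) :
    ∃ j, ∃ l, ∀ i, l ≤ i → loc i ∈ S j := by
  have hanti : Antitone fun i => idx (loc (m + i)) :=
    antitone_nat_of_succ_le fun i => hidx (m + i) (by omega)
  obtain ⟨l, hl⟩ := WellFoundedGT.monotone_chain_condition
    (⟨fun i => OrderDual.toDual (idx (loc (m + i))), hanti.dual_right⟩ : ℕ →o ℕᵒᵈ)
  obtain ⟨j, hj, -⟩ := hmem (m + l) (by omega)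
  refine ⟨j, m + l, fun i hi => ?_⟩
  obtain ⟨j', hj', hj''⟩ := hmem i (by omega)
  have : idx (loc (m + l)) = idx (loc i) := by
    have := hl (i - m) (by omega)
    have h2 : m + (i - m) = i := by omega
    simpa [h2] using this
  rwa [show j = j' from Fin.ext (by omega)]

/-- From a promising set, the union of the sets `Safe (B i)` can be reached and never left by an
almost blind and memoryless scheduler. -/
theorem exists_almostBlind_memoryless {n : ℕ} {B : Fin n → Set Q} {X : Set Q} {q : Q}
    (hX : N.L.IsPromisingFor (⋃ i, N.L.Safe (B i)) X)
    (hq : q ∈ (⋃ i, N.L.Safe (B i)) ∨ q ∈ X) :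
    ∃ U : Scheduler N, U.AlmostBlind ∧ U.Memoryless ∧
      U.Pr (q, eps C M) (⋃ i, evEvAlways (inLoc (B i))) = 1 := by
  obtain ⟨rk, hrk⟩ := hX.exists_rank
  obtain ⟨β, idx, hβ, hβA⟩ := exists_safe_rules N.L B
  set A : Set Q := ⋃ i, N.L.Safe (B i) with hA
  have : Nonempty (LcsRule Q C M) := ⟨β q⟩
  have : Nonempty (Conf Q C M) := ⟨(q, eps C M)⟩
  choose! ρ t hρ hrk ht using hrk
  let V : Scheduler N :=
    { choose := fun _ s => β s.1
      choose_mem := fun _ s => (hβ s.1).1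
      choose_enabled := fun _ s => enabledIn_of_not_isRecv (hβ s.1).2.2 (hβ s.1).2.1 }
  let U : Scheduler N :=
    { choose := fun _ s => if s.1 ∈ X ∧ s.1 ∉ A then ρ s else β s.1
      choose_mem := fun h s => by
        split_ifs with hs
        · exact (hρ s hs.1 hs.2).1
        · exact V.choose_mem h s
      choose_enabled := fun h s => by
        split_ifs with hs
        · exact (hρ s hs.1 hs.2).2.1
        · exact V.choose_enabled h s }
  have hUV : ∀ h s, ¬ (s.1 ∈ X ∧ s.1 ∉ A) → U.choose h s = β s.1 := fun h s hs => if_neg hs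
  have hUρ : ∀ h s, s.1 ∈ X ∧ s.1 ∉ A → U.choose h s = ρ s := fun h s hs => if_pos hs
  set bad : Set (ℕ → List (Conf Q C M) × Conf Q C M) :=
    {ω | ∃ i, U.kernel (ω i) (ω (i + 1)) = 0} ∪
      (evInfOften (fun b => b.2 ∉ {s : Conf Q C M | s.1 ∈ X ∧ s.1 ∉ A}))ᶜ with hbad
  have hnull : ∀ a, chainPr U.kernel a bad = 0 := fun a =>
    chainPr_union_null (chainPr_zero_step_null U.tsum_kernel a)
      (U.infOften_leave_of_rank rk (fun s hs =>
        ⟨ρ s, t s, fun h => hUρ h s hs, hρ s hs.1 hs.2, hrk s hs.1 hs.2⟩) a)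
  have hstep : ∀ ω ∉ bad, ∀ i, (ω (i + 1)).2.1 = (U.choose (ω i).1 (ω i).2).dst := by
    intro ω hω i
    have : U.kernel (ω i) (ω (i + 1)) ≠ 0 := fun h => hω (Or.inl ⟨i, h⟩)
    exact ((U.kernel_ne_zero_iff _ _).1 this).2.2.2.1
  have hstay : ∀ ω ∉ bad, ∀ i, (ω i).2.1 ∈ A → (ω (i + 1)).2.1 = (β (ω i).2.1).dst := by
    intro ω hω i hi
    rw [hstep ω hω, hUV _ _ fun h => h.2 hi]
  have hforever : ∀ ω ∉ bad, ∀ m, (ω m).2.1 ∈ A → ∀ i, m ≤ i → (ω i).2.1 ∈ A := by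
    intro ω hω m hm i hi
    induction i, hi using Nat.le_induction with
    | base => exact hm
    | succ i _ ih =>
      rw [hstay ω hω i ih]
      exact (hβA _ ih).1
  have hreach : ∀ ω ∉ bad, ∀ m, (ω m).2.1 ∈ X → ∃ i, (ω i).2.1 ∈ A := by
    intro ω hω m hm
    by_contra! hno
    have hall : ∀ i, m ≤ i → (ω i).2.1 ∈ X := by
      intro i hi
      induction i, hi using Nat.le_induction with
      | base => exact hm
      | succ i _ ih =>
        have h1 := ht (ω i).2 ih (hno i)
        rw [(hρ (ω i).2 ih (hno i)).2.2.1, ← hUρ (ω i).1 _ ⟨ih, hno i⟩, ← hstep ω hω i] at h1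
        exact h1.resolve_right (hno (i + 1))
    refine hω (Or.inr fun hio => ?_)
    obtain ⟨i, hi, hiT⟩ := hio m
    exact hiT ⟨hall i hi, hno i⟩
  refine ⟨U, ⟨U, V, fun h h' s s' _ hs => congrArg β hs, fun s => ?_⟩, fun h h' s => rfl, ?_⟩
  · refine chainPr_eq_one_of_compl U.tsum_kernel (chainPr_mono_null (fun ω _ hω => ?_)
      (hnull ([], s)))
    by_contra hgood
    refine hω ?_
    by_cases hex : ∃ m, (ω m).2.1 ∈ A
    · obtain ⟨m, hm⟩ := hex
      exact ⟨m, fun i _ => rfl, fun i hi =>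
        hUV _ _ fun h => h.2 (hforever ω hgood m hm i hi.le)⟩
    · exact ⟨0, fun i _ => rfl, fun i _ => hUV _ _ fun h => hex (hreach ω hgood i h.1)⟩
  · refine chainPr_eq_one_of_compl U.tsum_kernel (chainPr_mono_null (fun ω h0 hω => ?_)
      (hnull ([], (q, eps C M))))
    by_contra hgood
    refine hω ?_
    have hex : ∃ m, (ω m).2.1 ∈ A := by
      rcases hq with hq | hq
      · exact ⟨0, by rw [h0]; exact hq⟩
      · exact hreach ω hgood 0 (by rw [h0]; exact hq)
    obtain ⟨m, hm⟩ := hex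
    have hmem := hforever ω hgood m hm
    obtain ⟨j, l, hl⟩ := exists_eventually_mem (S := fun i => N.L.Safe (B i)) (idx := idx)
      (loc := fun i => (ω i).2.1) (m := m)
      (fun i hi => by
        rw [hstay ω hgood i (hmem i hi)]
        exact (hβA _ (hmem i hi)).2.1)
      (fun i hi => (hβA _ (hmem i hi)).2.2)
    exact Set.mem_iUnion.2 ⟨j, l, fun i hi => (isSafeFor_safe N.L (B j)).1 (hl i hi)⟩

end SchedulerLemmas

/-- `⋁ᵢ ◇□Bᵢ` holds almost surely under some scheduler iff it does under some
finite-memory scheduler (indeed under an almost blind, memoryless one), iff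
some scheduler reaches `⋃ᵢ Safe(Bᵢ)` almost surely. -/
theorem statement11 {Q C M : Type} [Fintype Q] [Fintype C] [DecidableEq C]
    [Fintype M] [DecidableEq M] (N : NPLCS Q C M) (q : Q) (n : ℕ)
    (B : Fin n → Set Q) :
    ((∃ U : Scheduler N,
        U.Pr (q, eps C M) (⋃ i, evEvAlways (inLoc (B i))) = 1) ↔
      ∃ U : Scheduler N, U.FiniteMemory ∧
        U.Pr (q, eps C M) (⋃ i, evEvAlways (inLoc (B i))) = 1)
    ∧ ((∃ U : Scheduler N,
        U.Pr (q, eps C M) (⋃ i, evEvAlways (inLoc (B i))) = 1) ↔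
      ∃ V : Scheduler N,
        V.Pr (q, eps C M) (evEventually (inLoc (⋃ i, N.L.Safe (B i)))) = 1)
    ∧ ((∃ U : Scheduler N,
        U.Pr (q, eps C M) (⋃ i, evEvAlways (inLoc (B i))) = 1) →
      ∃ U : Scheduler N, U.AlmostBlind ∧ U.Memoryless ∧
        U.Pr (q, eps C M) (⋃ i, evEvAlways (inLoc (B i))) = 1) := by
  have h13 := fun U : Scheduler N => U.pr_evEventually_safe (q, eps C M) (B := B)
  have h3 : ∀ V : Scheduler N, V.Pr (q, eps C M) (evEventually (inLoc (⋃ i, N.L.Safe (B i)))) = 1 →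
      ∃ U : Scheduler N, U.AlmostBlind ∧ U.Memoryless ∧
        U.Pr (q, eps C M) (⋃ i, evEvAlways (inLoc (B i))) = 1 := by
    intro V hV
    obtain ⟨X, hX, hq⟩ := V.exists_isPromisingFor hV
    exact exists_almostBlind_memoryless hX hq
  refine ⟨⟨?_, ?_⟩, ⟨?_, ?_⟩, ?_⟩
  · rintro ⟨U, hU⟩
    obtain ⟨U', -, hmem, hU'⟩ := h3 U (h13 U hU)
    exact ⟨U', hmem.finiteMemory, hU'⟩
  · rintro ⟨U, -, hU⟩
    exact ⟨U, hU⟩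
  · rintro ⟨U, hU⟩
    exact ⟨U, h13 U hU⟩
  · rintro ⟨V, hV⟩
    obtain ⟨U, -, -, hU⟩ := h3 V hV
    exact ⟨U, hU⟩
  · rintro ⟨U, hU⟩
    exact h3 U (h13 U hU)

end NPLCSmodel
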